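/- arXiv:2605.06831 — 7 statements merged into one kernel-verified Lean document; each statement's English description precedes it below -/
import Mathlib

section
/- Let y : [0,U] → ℝ^ϖ be differentiable and satisfy ẏ_u = μ̂_u(y_u) − y_u for every u ∈ [0,U], where μ̂_u is the posterior mean formed with variance σ̃_u². Assume that for every u ∈ [0,U] the point y_u satisfies two-mode dominance for (i,j) with margin parameter κ > 0 (with variance σ̃_u²). Set ε := (N−2) · (max_{k∉{i,j}} ‖μ^(k) − μ^(i)‖) · ((max_{k∉{i,j}} π_k)/min(π_i, π_j)) · exp(−κ), and let w_u := (y_u − μ^(i)) − ⟨y_u − μ^(i), v⟩ v be the component of y_u − μ^(i) orthogonal to v. Then for all u ∈ [0,U]: ‖w_u‖ ≤ e^{−u} ‖w_0‖ + ε (1 − e^{−u}). -/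
open Set
open scoped InnerProductSpace

/-- Responsibility of mode `k` at `y`, with variance parameter `σ̃²`. -/
noncomputable def resp {ϖ N : ℕ} (μ : Fin N → EuclideanSpace ℝ (Fin ϖ))
    (π : Fin N → ℝ) (σ : ℝ) (k : Fin N) (y : EuclideanSpace ℝ (Fin ϖ)) : ℝ :=
  π k * Real.exp (-‖y - μ k‖ ^ 2 / (2 * σ ^ 2)) /
    ∑ m : Fin N, π m * Real.exp (-‖y - μ m‖ ^ 2 / (2 * σ ^ 2))

/-- Posterior mean `μ̂(y) = ∑ₖ γₖ(y) μ⁽ᵏ⁾`. -/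
noncomputable def postMean {ϖ N : ℕ} (μ : Fin N → EuclideanSpace ℝ (Fin ϖ))
    (π : Fin N → ℝ) (σ : ℝ) (y : EuclideanSpace ℝ (Fin ϖ)) : EuclideanSpace ℝ (Fin ϖ) :=
  ∑ k : Fin N, resp μ π σ k y • μ k

/-- Two-mode dominance for the pair `(i,j)` with margin parameter `κ` and variance `σ̃²`. -/
def TwoModeDominance {ϖ N : ℕ} (μ : Fin N → EuclideanSpace ℝ (Fin ϖ))
    (σ : ℝ) (i j : Fin N) (κ : ℝ) (y : EuclideanSpace ℝ (Fin ϖ)) : Prop :=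
  ∀ k : Fin N, k ≠ i → k ≠ j →
    ‖y - μ k‖ ^ 2 ≥ min (‖y - μ i‖ ^ 2) (‖y - μ j‖ ^ 2) + 2 * σ ^ 2 * κ

/-- Removing the component along a unit vector does not increase the norm. -/
theorem norm_sub_inner_smul_le {E : Type*} [NormedAddCommGroup E] [InnerProductSpace ℝ E]
    {v : E} (hv : ‖v‖ = 1) (x : E) : ‖x - ⟪x, v⟫_ℝ • v‖ ≤ ‖x‖ := by
  rw [← sq_le_sq₀ (norm_nonneg _) (norm_nonneg _), norm_sub_sq_real, inner_smul_right,
    norm_smul, hv, Real.norm_eq_abs, mul_one, sq_abs]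
  nlinarith [sq_nonneg ⟪x, v⟫_ℝ]

/-- Gronwall-type bound for the linear equation `w' = f - w` with bounded forcing. -/
theorem norm_le_exp_neg_mul_add_of_hasDerivAt {E : Type*} [NormedAddCommGroup E]
    [NormedSpace ℝ E] {w f : ℝ → E} {U ε : ℝ}
    (hw : ∀ u ∈ Icc (0 : ℝ) U, HasDerivAt w (f u - w u) u)
    (hf : ∀ u ∈ Icc (0 : ℝ) U, ‖f u‖ ≤ ε) {u : ℝ} (hu : u ∈ Icc (0 : ℝ) U) :
    ‖w u‖ ≤ Real.exp (-u) * ‖w 0‖ + ε * (1 - Real.exp (-u)) := by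
  have hderiv : ∀ t ∈ Icc (0 : ℝ) U,
      HasDerivAt (fun s => Real.exp s • w s) (Real.exp t • f t) t := fun t ht =>
    ((Real.hasDerivAt_exp t).smul (hw t ht)).congr_deriv (by rw [smul_sub]; abel)
  have hbound : ∀ t, HasDerivAt (fun s => ‖w 0‖ + ε * (Real.exp s - 1))
      (ε * Real.exp t) t := fun t =>
    (((Real.hasDerivAt_exp t).sub_const 1).const_mul ε).const_add _
  have key := image_norm_le_of_norm_deriv_right_le_deriv_boundary
    (fun t ht => (hderiv t ht).continuousAt.continuousWithinAt)
    (fun t ht => (hderiv t (Ico_subset_Icc_self ht)).hasDerivWithinAt)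
    (by simp) hbound
    (fun t ht => by
      rw [norm_smul, Real.norm_eq_abs, Real.abs_exp, mul_comm]
      exact mul_le_mul_of_nonneg_right (hf t (Ico_subset_Icc_self ht)) (Real.exp_pos t).le) hu
  rw [norm_smul, Real.norm_eq_abs, Real.abs_exp] at key
  have hexp : Real.exp (-u) * Real.exp u = 1 := by rw [← Real.exp_add]; simp
  calc ‖w u‖ = Real.exp (-u) * (Real.exp u * ‖w u‖) := by rw [← mul_assoc, hexp, one_mul]
    _ ≤ Real.exp (-u) * (‖w 0‖ + ε * (Real.exp u - 1)) :=
      mul_le_mul_of_nonneg_left key (Real.exp_pos _).le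
    _ = _ := by linear_combination ε * hexp

section Responsibilities

variable {ϖ N : ℕ} {μ : Fin N → EuclideanSpace ℝ (Fin ϖ)} {π : Fin N → ℝ}

theorem resp_nonneg (hπ : ∀ k, 0 < π k) (σ : ℝ) (k : Fin N) (y : EuclideanSpace ℝ (Fin ϖ)) :
    0 ≤ resp μ π σ k y :=
  div_nonneg (mul_pos (hπ k) (Real.exp_pos _)).le
    (Finset.sum_nonneg fun m _ => (mul_pos (hπ m) (Real.exp_pos _)).le)

theorem sum_resp [Nonempty (Fin N)] (hπ : ∀ k, 0 < π k) (σ : ℝ) (y : EuclideanSpace ℝ (Fin ϖ)) :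
    ∑ k, resp μ π σ k y = 1 := by
  unfold resp
  rw [← Finset.sum_div]
  exact div_self (Finset.sum_pos (fun m _ => mul_pos (hπ m) (Real.exp_pos _))
    Finset.univ_nonempty).ne'

/-- A mode farther from `y` than mode `m` by a margin has exponentially small responsibility. -/
theorem resp_le_of_add_le (hπ : ∀ k, 0 < π k) {σ κ : ℝ} (hσ : 0 < σ) {k m : Fin N}
    {y : EuclideanSpace ℝ (Fin ϖ)} (h : ‖y - μ m‖ ^ 2 + 2 * σ ^ 2 * κ ≤ ‖y - μ k‖ ^ 2) :
    resp μ π σ k y ≤ π k / π m * Real.exp (-κ) := by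
  have hterm : ∀ l, 0 < π l * Real.exp (-‖y - μ l‖ ^ 2 / (2 * σ ^ 2)) :=
    fun l => mul_pos (hπ l) (Real.exp_pos _)
  have hexp : Real.exp (-‖y - μ k‖ ^ 2 / (2 * σ ^ 2)) ≤
      Real.exp (-κ) * Real.exp (-‖y - μ m‖ ^ 2 / (2 * σ ^ 2)) := by
    rw [← Real.exp_add, Real.exp_le_exp, ← sub_nonneg]
    have : -κ + -‖y - μ m‖ ^ 2 / (2 * σ ^ 2) - -‖y - μ k‖ ^ 2 / (2 * σ ^ 2) =
        (‖y - μ k‖ ^ 2 - (‖y - μ m‖ ^ 2 + 2 * σ ^ 2 * κ)) / (2 * σ ^ 2) := by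
      field_simp; ring
    rw [this]
    exact div_nonneg (sub_nonneg.2 h) (by positivity)
  calc resp μ π σ k y
      ≤ π k * Real.exp (-‖y - μ k‖ ^ 2 / (2 * σ ^ 2)) /
          (π m * Real.exp (-‖y - μ m‖ ^ 2 / (2 * σ ^ 2))) :=
        div_le_div_of_nonneg_left (hterm k).le (hterm m)
          (Finset.single_le_sum (fun l _ => (hterm l).le) (Finset.mem_univ m))
    _ ≤ π k * (Real.exp (-κ) * Real.exp (-‖y - μ m‖ ^ 2 / (2 * σ ^ 2))) /
          (π m * Real.exp (-‖y - μ m‖ ^ 2 / (2 * σ ^ 2))) :=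
        div_le_div_of_nonneg_right (mul_le_mul_of_nonneg_left hexp (hπ k).le) (hterm m).le
    _ = π k / π m * Real.exp (-κ) := by
        have := (hπ m).ne'
        field_simp

/-- Under two-mode dominance every other mode has exponentially small responsibility. -/
theorem TwoModeDominance.resp_le (hπ : ∀ k, 0 < π k) {σ κ : ℝ} (hσ : 0 < σ) {i j k : Fin N}
    {y : EuclideanSpace ℝ (Fin ϖ)} (h : TwoModeDominance μ σ i j κ y) (hi : k ≠ i)
    (hj : k ≠ j) : resp μ π σ k y ≤ π k / min (π i) (π j) * Real.exp (-κ) := by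
  have hmin : 0 < min (π i) (π j) := lt_min (hπ i) (hπ j)
  have hk := h k hi hj
  have weaken : ∀ m, min (π i) (π j) ≤ π m →
      π k / π m * Real.exp (-κ) ≤ π k / min (π i) (π j) * Real.exp (-κ) := fun m hm =>
    mul_le_mul_of_nonneg_right (div_le_div_of_nonneg_left (hπ k).le hmin hm) (Real.exp_pos _).le
  rcases min_choice (‖y - μ i‖ ^ 2) (‖y - μ j‖ ^ 2) with hm | hm <;> rw [hm] at hk
  · exact (resp_le_of_add_le hπ hσ hk).trans (weaken i (min_le_left _ _))
  · exact (resp_le_of_add_le hπ hσ hk).trans (weaken j (min_le_right _ _))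

/-- A contraction killing `μ j - μ i` makes the displacement of the posterior mean from `μ i`
exponentially small under two-mode dominance. -/
theorem TwoModeDominance.norm_map_postMean_sub_le (hN : 2 ≤ N) (hπ : ∀ k, 0 < π k) {σ κ : ℝ}
    (hσ : 0 < σ) {i j : Fin N} (hij : i ≠ j) {y : EuclideanSpace ℝ (Fin ϖ)}
    (h : TwoModeDominance μ σ i j κ y)
    (L : EuclideanSpace ℝ (Fin ϖ) →L[ℝ] EuclideanSpace ℝ (Fin ϖ)) (hL : ∀ x, ‖L x‖ ≤ ‖x‖)
    (hLij : L (μ j - μ i) = 0) :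
    ‖L (postMean μ π σ y - μ i)‖ ≤
      (N - 2 : ℝ) * (⨆ k : {k : Fin N // k ≠ i ∧ k ≠ j}, ‖μ k.1 - μ i‖) *
      ((⨆ k : {k : Fin N // k ≠ i ∧ k ≠ j}, π k.1) / min (π i) (π j)) * Real.exp (-κ) := by
  set M := ⨆ k : {k : Fin N // k ≠ i ∧ k ≠ j}, ‖μ k.1 - μ i‖
  set P := ⨆ k : {k : Fin N // k ≠ i ∧ k ≠ j}, π k.1
  have hmin : 0 < min (π i) (π j) := lt_min (hπ i) (hπ j)
  have hdisp : postMean μ π σ y - μ i = ∑ k, resp μ π σ k y • (μ k - μ i) := by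
    have : Nonempty (Fin N) := ⟨i⟩
    simp_rw [smul_sub]
    rw [Finset.sum_sub_distrib, ← Finset.sum_smul, sum_resp hπ σ, one_smul, postMean]
  have hcard : (((Finset.univ.erase i).erase j).card : ℝ) = N - 2 := by
    rw [Finset.card_erase_of_mem (by simp [hij.symm]), Finset.card_erase_of_mem (by simp),
      Finset.card_univ, Fintype.card_fin, Nat.sub_sub, Nat.cast_sub hN]
    norm_num
  have hterm : ∀ k ∈ (Finset.univ.erase i).erase j,
      ‖L (resp μ π σ k y • (μ k - μ i))‖ ≤ P / min (π i) (π j) * Real.exp (-κ) * M := by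
    intro k hk
    simp only [Finset.mem_erase, Finset.mem_univ, and_true] at hk
    have hM : ‖μ k - μ i‖ ≤ M :=
      le_ciSup (f := fun k : {k : Fin N // k ≠ i ∧ k ≠ j} => ‖μ k.1 - μ i‖)
        (Set.finite_range _).bddAbove ⟨k, hk.2, hk.1⟩
    have hP : π k ≤ P :=
      le_ciSup (f := fun k : {k : Fin N // k ≠ i ∧ k ≠ j} => π k.1)
        (Set.finite_range _).bddAbove ⟨k, hk.2, hk.1⟩
    have hP0 : 0 ≤ P := (hπ k).le.trans hP
    refine (hL _).trans ?_
    rw [norm_smul, Real.norm_of_nonneg (resp_nonneg hπ σ k y)]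
    refine mul_le_mul ((h.resp_le hπ hσ hk.2 hk.1).trans ?_) hM (norm_nonneg _) (by positivity)
    gcongr
  rw [hdisp, map_sum, ← Finset.sum_erase Finset.univ (a := i) (by simp),
    ← Finset.sum_erase (Finset.univ.erase i) (a := j) (by rw [map_smul, hLij, smul_zero])]
  calc _ ≤ _ := norm_sum_le_of_le _ hterm
    _ = _ := by rw [Finset.sum_const, nsmul_eq_mul, hcard]; ring

end Responsibilities

/-- Exponential decay of the orthogonal component of a solution of the
rescaled reverse ODE `ẏᵤ = μ̂ᵤ(yᵤ) − yᵤ` under two-mode dominance. -/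
theorem orthogonal_component_exponential_decay
    (ϖ N : ℕ) (hϖ : 1 ≤ ϖ) (hN : 2 ≤ N)
    (μ : Fin N → EuclideanSpace ℝ (Fin ϖ)) (π : Fin N → ℝ)
    (hπpos : ∀ k, 0 < π k) (hπsum : ∑ k : Fin N, π k = 1)
    (i j : Fin N) (hij : i ≠ j) (hμ : μ i ≠ μ j)
    (v : EuclideanSpace ℝ (Fin ϖ)) (hv : v = ‖μ j - μ i‖⁻¹ • (μ j - μ i))
    (U : ℝ) (hU : 0 ≤ U)
    (σt : ℝ → ℝ) (hσt : ∀ u ∈ Icc (0 : ℝ) U, 0 < σt u)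
    (κ : ℝ) (hκ : 0 < κ)
    (y : ℝ → EuclideanSpace ℝ (Fin ϖ))
    (hy : ∀ u ∈ Icc (0 : ℝ) U, HasDerivAt y (postMean μ π (σt u) (y u) - y u) u)
    (hdom : ∀ u ∈ Icc (0 : ℝ) U, TwoModeDominance μ (σt u) i j κ (y u))
    (ε : ℝ)
    (hε : ε = (N - 2 : ℝ) * (⨆ k : {k : Fin N // k ≠ i ∧ k ≠ j}, ‖μ k.1 - μ i‖) *
      ((⨆ k : {k : Fin N // k ≠ i ∧ k ≠ j}, π k.1) / min (π i) (π j)) * Real.exp (-κ))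
    (w : ℝ → EuclideanSpace ℝ (Fin ϖ))
    (hw : ∀ u, w u = (y u - μ i) - ⟪y u - μ i, v⟫_ℝ • v) :
    ∀ u ∈ Icc (0 : ℝ) U,
      ‖w u‖ ≤ Real.exp (-u) * ‖w 0‖ + ε * (1 - Real.exp (-u)) := by
  have hnorm : ‖μ j - μ i‖ ≠ 0 := norm_ne_zero_iff.2 (sub_ne_zero.2 hμ.symm)
  have hv1 : ‖v‖ = 1 := by
    rw [hv, norm_smul, norm_inv, norm_norm, inv_mul_cancel₀ hnorm]
  let L : EuclideanSpace ℝ (Fin ϖ) →L[ℝ] EuclideanSpace ℝ (Fin ϖ) :=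
    ContinuousLinearMap.id ℝ _ - (innerSL ℝ v).smulRight v
  have hLapp : ∀ x, L x = x - ⟪x, v⟫_ℝ • v := fun x => by
    simp [L, real_inner_comm]
  have hLij : L (μ j - μ i) = 0 := by
    have hdir : μ j - μ i = ‖μ j - μ i‖ • v := by
      rw [hv, smul_smul, mul_inv_cancel₀ hnorm, one_smul]
    rw [hdir, map_smul, hLapp, real_inner_self_eq_norm_sq, hv1]
    simp
  have hwL : w = fun u => L (y u - μ i) := funext fun u => by rw [hw, hLapp]
  intro u hu
  refine norm_le_exp_neg_mul_add_of_hasDerivAt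
    (f := fun t => L (postMean μ π (σt t) (y t) - μ i)) (fun t ht => ?_) (fun t ht => ?_) hu
  · rw [hwL]
    refine (L.hasFDerivAt.comp_hasDerivAt t ((hy t ht).sub_const (μ i))).congr_deriv ?_
    rw [← map_sub]
    congr 1
    abel
  · rw [hε]
    exact (hdom t ht).norm_map_postMean_sub_le hN hπpos (hσt t ht) hij L
      (fun x => hLapp x ▸ norm_sub_inner_smul_le hv1 x) hLij
end

section
/- Let ε > 0 and let ξ : [0,U] → ℝ be differentiable with ξ'_u = g_u − ξ_u + δ_u for all u ∈ [0,U], where g, δ : [0,U] → ℝ satisfy 0 ≤ g_u ≤ 1 and |δ_u| ≤ ε/2 for all u. Then: (i) if ξ_{u₀} ∈ [−ε, 1+ε] for some u₀ ∈ [0,U], then ξ_u ∈ [−ε, 1+ε] for all u ∈ [u₀, U]; (ii) setting r₀ := max(ξ_0 − (1+ε), −ε − ξ_0, 0), one has ξ_u ∈ [−ε, 1+ε] for every u ∈ [0,U] with u ≥ log(1 + 2r₀/ε). -/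
open Set

/-- Comparison for the relaxation equation `f' = h − f` with forcing `h ≤ M`: an excess of at most
`r` over `M` at time `a` has decayed to at most `s` at any later time `b` with
`r * exp a ≤ s * exp b`. -/
theorem le_add_of_hasDerivAt_sub_self {f h : ℝ → ℝ} {a b M r s : ℝ} (hab : a ≤ b)
    (hf : ∀ u ∈ Icc a b, HasDerivAt f (h u - f u) u) (hh : ∀ u ∈ Icc a b, h u ≤ M)
    (ha : f a ≤ M + r) (hrs : r * Real.exp a ≤ s * Real.exp b) : f b ≤ M + s := by
  have hd : ∀ u ∈ Icc a b, HasDerivAt (fun v => Real.exp v * (f v - M))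
      (Real.exp u * (f u - M) + Real.exp u * (h u - f u)) u := fun u hu =>
    (Real.hasDerivAt_exp u).mul ((hf u hu).sub_const M)
  have hanti : AntitoneOn (fun v => Real.exp v * (f v - M)) (Icc a b) := by
    refine antitoneOn_of_deriv_nonpos (convex_Icc a b)
      (fun u hu => (hd u hu).continuousAt.continuousWithinAt)
      (fun u hu => (hd u (interior_subset hu)).differentiableAt.differentiableWithinAt)
      fun u hu => ?_
    rw [(hd u (interior_subset hu)).deriv]
    nlinarith [Real.exp_pos u, hh u (interior_subset hu)]
  have hle : Real.exp b * (f b - M) ≤ Real.exp a * (f a - M) :=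
    hanti (left_mem_Icc.2 hab) (right_mem_Icc.2 hab) hab
  have hr : Real.exp a * (f a - M) ≤ Real.exp a * r :=
    mul_le_mul_of_nonneg_left (by linarith) (Real.exp_pos a).le
  have hs : Real.exp b * (f b - M) ≤ Real.exp b * s := by linarith
  linarith [le_of_mul_le_mul_left hs (Real.exp_pos b)]


/-- Confinement of the parallel coordinate: for the scalar ODE
`ξ' = g − ξ + δ` with `0 ≤ g ≤ 1` and `|δ| ≤ ε/2`, the interval `[−ε, 1+ε]` is forward
invariant, and every solution enters it after time `log(1 + 2r₀/ε)`. -/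
theorem parallel_coordinate_confinement
    (U ε : ℝ) (hU : 0 ≤ U) (hε : 0 < ε)
    (ξ g δ : ℝ → ℝ)
    (hξ : ∀ u ∈ Icc (0 : ℝ) U, HasDerivAt ξ (g u - ξ u + δ u) u)
    (hg : ∀ u ∈ Icc (0 : ℝ) U, 0 ≤ g u ∧ g u ≤ 1)
    (hδ : ∀ u ∈ Icc (0 : ℝ) U, |δ u| ≤ ε / 2) :
    (∀ u₀ ∈ Icc (0 : ℝ) U, ξ u₀ ∈ Icc (-ε) (1 + ε) →
        ∀ u ∈ Icc u₀ U, ξ u ∈ Icc (-ε) (1 + ε)) ∧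
      (∀ u ∈ Icc (0 : ℝ) U,
        Real.log (1 + 2 * max (max (ξ 0 - (1 + ε)) (-ε - ξ 0)) 0 / ε) ≤ u →
          ξ u ∈ Icc (-ε) (1 + ε)) := by
  have confined : ∀ a b r, 0 ≤ a → a ≤ b → b ≤ U → ξ a ≤ 1 + ε / 2 + r → -ξ a ≤ ε / 2 + r →
      r * Real.exp a ≤ ε / 2 * Real.exp b → ξ b ∈ Icc (-ε) (1 + ε) := by
    intro a b r ha hab hb h₁ h₂ hr
    have hmem : ∀ u ∈ Icc a b, u ∈ Icc (0 : ℝ) U := fun u hu =>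
      ⟨ha.trans hu.1, hu.2.trans hb⟩
    have upper : ξ b ≤ 1 + ε / 2 + ε / 2 :=
      le_add_of_hasDerivAt_sub_self (h := fun u => g u + δ u) hab
        (fun u hu => (hξ u (hmem u hu)).congr_deriv (by ring))
        (fun u hu => by linarith [hg u (hmem u hu), abs_le.1 (hδ u (hmem u hu))]) h₁ hr
    have lower : -ξ b ≤ ε / 2 + ε / 2 :=
      le_add_of_hasDerivAt_sub_self (f := fun u => -ξ u) (h := fun u => -(g u + δ u)) hab
        (fun u hu => (hξ u (hmem u hu)).fun_neg.congr_deriv (by ring))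
        (fun u hu => by linarith [hg u (hmem u hu), abs_le.1 (hδ u (hmem u hu))]) h₂ hr
    constructor <;> linarith
  refine ⟨fun u₀ hu₀ h₀ u hu => ?_, fun u hu hlog => ?_⟩
  · refine confined u₀ u (ε / 2) hu₀.1 hu.1 hu.2 (by linarith [h₀.2]) (by linarith [h₀.1]) ?_
    exact mul_le_mul_of_nonneg_left (Real.exp_le_exp.2 hu.1) (by positivity)
  · set r := max (max (ξ 0 - (1 + ε)) (-ε - ξ 0)) 0
    have hr0 : 0 ≤ r := le_max_right _ _
    have h₁ : ξ 0 - (1 + ε) ≤ r := (le_max_left _ _).trans (le_max_left _ _)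
    have h₂ : -ε - ξ 0 ≤ r := (le_max_right _ _).trans (le_max_left _ _)
    have hexp : 1 + 2 * r / ε ≤ Real.exp u := (Real.log_le_iff_le_exp (by positivity)).1 hlog
    refine confined 0 u (r + ε / 2) le_rfl hu.1 hu.2 (by linarith) (by linarith) ?_
    calc (r + ε / 2) * Real.exp 0 = ε / 2 * (1 + 2 * r / ε) := by
          rw [Real.exp_zero]; field_simp; ring
      _ ≤ ε / 2 * Real.exp u := mul_le_mul_of_nonneg_left hexp (by positivity)
end

section
/- Assume π_i = π_j. Fix w ∈ ℝ^ϖ with ⟨w, v⟩ = 0 and define F : ℝ → ℝ by F(ξ) := γ^(ij)(μ^(i) + ξ ℓ v + w) − ξ. Then F(1/2) = 0 and F'(1/2) = ℓ²/(4σ̃²) − 1. In particular, if ℓ² ≥ 4κσ̃² for some κ > 1, then F'(1/2) ≥ κ − 1 > 0, so 1/2 is a hyperbolic unstable equilibrium of the drift F. -/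
open Set
open scoped InnerProductSpace

/-- Two-mode responsibility of mode `j` at `y`, with variance parameter `σ̃²`. -/
noncomputable def resp2 {ϖ : ℕ} (μi μj : EuclideanSpace ℝ (Fin ϖ))
    (πi πj σ : ℝ) (y : EuclideanSpace ℝ (Fin ϖ)) : ℝ :=
  πj * Real.exp (-‖y - μj‖ ^ 2 / (2 * σ ^ 2)) /
    (πi * Real.exp (-‖y - μi‖ ^ 2 / (2 * σ ^ 2)) +
      πj * Real.exp (-‖y - μj‖ ^ 2 / (2 * σ ^ 2)))

/-- With equal weights, the two-mode responsibility is the logistic sigmoid of the difference of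
the Gaussian exponents. -/
theorem resp2_self_weight_eq_sigmoid {ϖ : ℕ} (μi μj : EuclideanSpace ℝ (Fin ϖ))
    {p : ℝ} (hp : p ≠ 0) (σ : ℝ) (y : EuclideanSpace ℝ (Fin ϖ)) :
    resp2 μi μj p p σ y = Real.sigmoid ((‖y - μi‖ ^ 2 - ‖y - μj‖ ^ 2) / (2 * σ ^ 2)) := by
  have hexp : Real.exp (-((‖y - μi‖ ^ 2 - ‖y - μj‖ ^ 2) / (2 * σ ^ 2))) =
      Real.exp (-‖y - μi‖ ^ 2 / (2 * σ ^ 2)) / Real.exp (-‖y - μj‖ ^ 2 / (2 * σ ^ 2)) := by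
    rw [← Real.exp_sub]
    ring_nf
  rw [Real.sigmoid_def, hexp, resp2, ← mul_add, mul_div_mul_left _ _ hp]
  have hj := Real.exp_pos (-‖y - μj‖ ^ 2 / (2 * σ ^ 2))
  field_simp
  ring

/-- The difference of squared distances to `a` and `a + u` at a point displaced from `a` by `t • u`
plus a vector orthogonal to `u`. -/
theorem norm_sq_sub_norm_sq_of_orthogonal {E : Type*} [NormedAddCommGroup E]
    [InnerProductSpace ℝ E] (a u w : E) (h : ⟪w, u⟫_ℝ = 0) (t : ℝ) :
    ‖a + t • u + w - a‖ ^ 2 - ‖a + t • u + w - (a + u)‖ ^ 2 = (2 * t - 1) * ‖u‖ ^ 2 := by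
  have hi : a + t • u + w - a = w + t • u := by abel
  have hj : a + t • u + w - (a + u) = w + (t - 1) • u := by module
  rw [hi, hj, norm_add_sq_real, norm_add_sq_real, inner_smul_right, inner_smul_right, h,
    norm_smul, norm_smul, mul_pow, mul_pow, Real.norm_eq_abs, Real.norm_eq_abs, sq_abs, sq_abs]
  ring

/-- With equal weights, the midpoint `ξ = 1/2` is an equilibrium of the
approximate parallel drift `F(ξ) = γ⁽ⁱʲ⁾(μ⁽ⁱ⁾ + ξℓv + w) − ξ`, with derivative
`F'(1/2) = ℓ²/(4σ̃²) − 1`; if `ℓ² ≥ 4κσ̃²` with `κ > 1`, this derivative is positive, so the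
midpoint is a hyperbolic unstable equilibrium. -/
theorem midpoint_unstable_equilibrium
    (ϖ : ℕ) (hϖ : 1 ≤ ϖ)
    (μi μj : EuclideanSpace ℝ (Fin ϖ)) (hμ : μi ≠ μj)
    (πi πj : ℝ) (hπi : 0 < πi) (hπj : 0 < πj) (hππ : πi = πj)
    (σt : ℝ) (hσt : 0 < σt)
    (ℓ : ℝ) (hℓ : ℓ = ‖μj - μi‖)
    (v : EuclideanSpace ℝ (Fin ϖ)) (hv : v = ℓ⁻¹ • (μj - μi))
    (w : EuclideanSpace ℝ (Fin ϖ)) (hw : ⟪w, v⟫_ℝ = 0)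
    (F : ℝ → ℝ)
    (hF : ∀ ξ : ℝ, F ξ = resp2 μi μj πi πj σt (μi + (ξ * ℓ) • v + w) - ξ) :
    F (1 / 2) = 0 ∧
      HasDerivAt F (ℓ ^ 2 / (4 * σt ^ 2) - 1) (1 / 2) ∧
      (∀ κ : ℝ, 1 < κ → 4 * κ * σt ^ 2 ≤ ℓ ^ 2 →
        κ - 1 ≤ ℓ ^ 2 / (4 * σt ^ 2) - 1 ∧ 0 < ℓ ^ 2 / (4 * σt ^ 2) - 1) := by
  subst hππ
  have hℓ0 : ℓ ≠ 0 := by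
    rw [hℓ]
    exact norm_ne_zero_iff.mpr (sub_ne_zero.mpr hμ.symm)
  have hℓv : ℓ • v = μj - μi := by rw [hv, smul_inv_smul₀ hℓ0]
  have horth : ⟪w, μj - μi⟫_ℝ = 0 := by rw [← hℓv, inner_smul_right, hw, mul_zero]
  have hFsig : F = fun ξ => Real.sigmoid ((2 * ξ - 1) * ℓ ^ 2 / (2 * σt ^ 2)) - ξ := by
    funext ξ
    have hdist := norm_sq_sub_norm_sq_of_orthogonal μi (μj - μi) w horth ξ
    rw [add_sub_cancel, ← hℓ] at hdist
    rw [hF, mul_smul, hℓv, resp2_self_weight_eq_sigmoid μi μj hπi.ne', hdist]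
  have hmid : (2 * (1 / 2 : ℝ) - 1) * ℓ ^ 2 / (2 * σt ^ 2) = 0 := by norm_num
  have hσ : 0 < 4 * σt ^ 2 := by positivity
  refine ⟨?_, ?_, fun κ hκ hle => ?_⟩
  · simp only [hFsig, hmid, Real.sigmoid_zero]
    norm_num
  · have harg : HasDerivAt (fun ξ : ℝ => (2 * ξ - 1) * ℓ ^ 2 / (2 * σt ^ 2))
        (2 * 1 * ℓ ^ 2 / (2 * σt ^ 2)) (1 / 2) :=
      ((((hasDerivAt_id _).const_mul 2).sub_const 1).mul_const _).div_const _
    rw [hFsig]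
    refine (((Real.hasDerivAt_sigmoid _).comp _ harg).sub (hasDerivAt_id _)).congr_deriv ?_
    rw [hmid, Real.sigmoid_zero]
    field_simp
    ring
  · have hκle : κ ≤ ℓ ^ 2 / (4 * σt ^ 2) := by
      rw [le_div_iff₀ hσ]
      linarith
    constructor <;> linarith
end

section
/- Let τ > 0 and 0 < λ_min ≤ λ_max. Let F : [0,τ] × ℝ → ℝ be such that for each s ∈ [0,τ] the map ξ ↦ F(s,ξ) is twice differentiable with F(s, 1/2) = 0, λ_s := ∂_ξ F(s, 1/2) ∈ [λ_min, λ_max], and |∂²_ξ F(s, ξ)| ≤ 4(1+λ_s)² for all ξ ∈ ℝ. Choose ϑ ∈ (0, 1/2] with ϑ < λ_min/(2(1+λ_max)²), and set Λ₊ := λ_max + 2(1+λ_max)² ϑ. If ζ : [0,τ] → ℝ is differentiable with ζ'_s = F(s, ζ_s) for all s ∈ [0,τ] and 0 < |ζ_0 − 1/2| < ϑ exp(−Λ₊ τ), then |ζ_s − 1/2| < ϑ for every s ∈ [0,τ]. Equivalently, if |ζ_s − 1/2| ≥ ϑ for some s ∈ [0,τ], then τ ≥ (1/Λ₊) log(ϑ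 / |ζ_0 − 1/2|). -/
open Set

/-- First-order Taylor estimate with a bound on the second derivative. -/
lemma abs_sub_sub_mul_le_of_abs_deriv2_le {g g' g'' : ℝ → ℝ} {M : ℝ}
    (h1 : ∀ x, HasDerivAt g (g' x) x) (h2 : ∀ x, HasDerivAt g' (g'' x) x)
    (hM : ∀ x, |g'' x| ≤ M) (a d : ℝ) :
    |g (a + d) - g a - g' a * d| ≤ M / 2 * d ^ 2 := by
  have hlip (x : ℝ) : |g' x - g' a| ≤ M * |x - a| := by
    simpa using convex_univ.norm_image_sub_le_of_norm_hasDerivWithin_le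
      (fun x _ => (h2 x).hasDerivWithinAt) (fun x _ => hM x) (mem_univ a) (mem_univ x)
  have hf (t : ℝ) : HasDerivAt (fun t => g (a + t * d) - g a - g' a * (t * d))
      ((g' (a + t * d) - g' a) * d) t := by
    have hl : HasDerivAt (fun t : ℝ => t * d) d t := by
      simpa using (hasDerivAt_id t).mul_const d
    have := (((h1 (a + t * d)).comp t (hl.const_add a)).sub_const (g a)).sub
      (hl.const_mul (g' a))
    exact this.congr_deriv (by ring)
  have hB (t : ℝ) : HasDerivAt (fun t : ℝ => M / 2 * d ^ 2 * t ^ 2) (M * d ^ 2 * t) t := by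
    have := (hasDerivAt_pow 2 t).const_mul (M / 2 * d ^ 2)
    exact this.congr_deriv (by norm_num; ring)
  have key := image_norm_le_of_norm_deriv_right_le_deriv_boundary
    (a := 0) (b := 1) (fun t _ => (hf t).continuousAt.continuousWithinAt)
    (fun t _ => (hf t).hasDerivWithinAt) (by simp) hB
    (fun t ht => by
      rw [Real.norm_eq_abs, abs_mul]
      have h := mul_le_mul_of_nonneg_right (hlip (a + t * d)) (abs_nonneg d)
      rw [add_sub_cancel_left, abs_mul, abs_of_nonneg ht.1] at h
      exact h.trans_eq (by rw [← sq_abs d]; ring))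
    (right_mem_Icc.2 zero_le_one)
  simpa using key

/-- Trapping near the midpoint: if the time-dependent scalar drift `F`
vanishes at `1/2`, has state-derivative `λ_s ∈ [λ_min, λ_max]` at `1/2` and second
state-derivative bounded by `4(1+λ_s)²`, then any solution `ζ` of `ζ' = F(s, ζ)` starting
within `ϑ exp(−Λ₊ τ)` of the midpoint (but not at it) remains within `ϑ` of the midpoint for
the whole time interval `[0, τ]`. -/
theorem midpoint_trapping
    (τ lamMin lamMax : ℝ) (hτ : 0 < τ) (hlam : 0 < lamMin) (hlamle : lamMin ≤ lamMax)
    (F F' F'' : ℝ → ℝ → ℝ)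
    (hd1 : ∀ s ∈ Icc (0 : ℝ) τ, ∀ ξ : ℝ, HasDerivAt (F s) (F' s ξ) ξ)
    (hd2 : ∀ s ∈ Icc (0 : ℝ) τ, ∀ ξ : ℝ, HasDerivAt (F' s) (F'' s ξ) ξ)
    (hF0 : ∀ s ∈ Icc (0 : ℝ) τ, F s (1 / 2) = 0)
    (hlamIn : ∀ s ∈ Icc (0 : ℝ) τ, F' s (1 / 2) ∈ Icc lamMin lamMax)
    (hF'' : ∀ s ∈ Icc (0 : ℝ) τ, ∀ ξ : ℝ, |F'' s ξ| ≤ 4 * (1 + F' s (1 / 2)) ^ 2)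
    (ϑ : ℝ) (hϑ0 : 0 < ϑ) (hϑhalf : ϑ ≤ 1 / 2)
    (hϑ : ϑ < lamMin / (2 * (1 + lamMax) ^ 2))
    (Λp : ℝ) (hΛp : Λp = lamMax + 2 * (1 + lamMax) ^ 2 * ϑ)
    (ζ : ℝ → ℝ)
    (hζ : ∀ s ∈ Icc (0 : ℝ) τ, HasDerivAt ζ (F s (ζ s)) s)
    (hinit0 : 0 < |ζ 0 - 1 / 2|)
    (hinit : |ζ 0 - 1 / 2| < ϑ * Real.exp (-Λp * τ)) :
    ∀ s ∈ Icc (0 : ℝ) τ, |ζ s - 1 / 2| < ϑ := by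
  have hc : 0 < 2 * (1 + lamMax) ^ 2 := by
    have : 0 < 1 + lamMax := by linarith
    positivity
  have hΛ : 0 < Λp := by
    have := mul_pos hc hϑ0
    linarith
  have hdrift (s : ℝ) (hs : s ∈ Icc 0 τ) (x : ℝ) :
      |F s x| ≤ lamMax * |x - 1 / 2| + 2 * (1 + lamMax) ^ 2 * |x - 1 / 2| ^ 2 := by
    have hT := abs_sub_sub_mul_le_of_abs_deriv2_le (hd1 s hs) (hd2 s hs) (hF'' s hs)
      (1 / 2) (x - 1 / 2)
    rw [add_sub_cancel, hF0 s hs, sub_zero, ← sq_abs (x - 1 / 2)] at hT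
    obtain ⟨hl, hu⟩ := hlamIn s hs
    have htri := abs_sub_abs_le_abs_sub (F s x) (F' s (1 / 2) * (x - 1 / 2))
    rw [abs_mul, abs_of_pos (hlam.trans_le hl)] at htri
    have hlin := mul_le_mul_of_nonneg_right hu (abs_nonneg (x - 1 / 2))
    have hsq : (1 + F' s (1 / 2)) ^ 2 ≤ (1 + lamMax) ^ 2 :=
      pow_le_pow_left₀ (by linarith) (by linarith) 2
    have hquad := mul_le_mul_of_nonneg_right hsq (sq_nonneg |x - 1 / 2|)
    linarith
  have hB (s : ℝ) : HasDerivAt (fun s => |ζ 0 - 1 / 2| * Real.exp (Λp * s))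
      (Λp * (|ζ 0 - 1 / 2| * Real.exp (Λp * s))) s := by
    have hl : HasDerivAt (fun s : ℝ => Λp * s) Λp s := by
      simpa using (hasDerivAt_id s).const_mul Λp
    exact (hl.exp.const_mul |ζ 0 - 1 / 2|).congr_deriv (by ring)
  have hBlt (s : ℝ) (hs : s ≤ τ) : |ζ 0 - 1 / 2| * Real.exp (Λp * s) < ϑ := by
    calc |ζ 0 - 1 / 2| * Real.exp (Λp * s)
        < ϑ * Real.exp (-Λp * τ) * Real.exp (Λp * s) := by gcongr
      _ = ϑ * Real.exp (Λp * (s - τ)) := by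
        rw [mul_assoc, ← Real.exp_add]
        ring_nf
      _ ≤ ϑ * 1 := by
        gcongr
        exact Real.exp_le_one_iff.2 (mul_nonpos_of_nonneg_of_nonpos hΛ.le (by linarith))
      _ = ϑ := mul_one ϑ
  intro s hs
  refine lt_of_le_of_lt ?_ (hBlt s hs.2)
  refine image_norm_le_of_norm_deriv_right_lt_deriv_boundary (f := fun s => ζ s - 1 / 2)
    (fun t ht => ((hζ t ht).sub_const _).continuousAt.continuousWithinAt)
    (fun t ht => ((hζ t (Ico_subset_Icc_self ht)).sub_const _).hasDerivWithinAt)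
    (by simp) hB (fun t ht heq => ?_) hs
  rw [Real.norm_eq_abs] at heq ⊢
  have hpos : 0 < |ζ t - 1 / 2| := by
    rw [heq]
    positivity
  have hlt : |ζ t - 1 / 2| < ϑ := heq.trans_lt (hBlt t ht.2.le)
  rw [← heq, hΛp]
  have := mul_lt_mul_of_pos_left (mul_lt_mul_of_pos_right hlt hpos) hc
  linarith [hdrift t (Ico_subset_Icc_self ht) (ζ t)]
end

section
/- Let m > 0, let J ⊆ ℝ be an interval, and let F : [t₀, t₁] × ℝ → ℝ be such that for each t the map ξ ↦ F(t,ξ) is differentiable with ∂_ξ F(t, ξ) ≤ −m/2 for all ξ ∈ J. If ξ¹, ξ² : [t₀, t₁] → ℝ are differentiable, satisfy (ξ¹)'_t = F(t, ξ¹_t) and (ξ²)'_t = F(t, ξ²_t) for all t, and ξ¹_t ∈ J and ξ²_t ∈ J for all t ∈ [t₀, t₁], then for every t ∈ [t₀, t₁]: |ξ¹_t − ξ²_t| ≤ exp(−(m/2)(t − t₀)) · |ξ¹_{t₀} − ξ²_{t₀}|. -/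
open Set

/-- A function on an interval whose derivative is at most `c` is one-sided Lipschitz with
constant `c`. -/
theorem sub_mul_sub_le_of_hasDerivWithinAt_le {J : Set ℝ} (hJ : J.OrdConnected)
    {f f' : ℝ → ℝ} {c : ℝ} (hd : ∀ x ∈ J, HasDerivWithinAt f (f' x) J x)
    (hc : ∀ x ∈ J, f' x ≤ c) {x y : ℝ} (hx : x ∈ J) (hy : y ∈ J) :
    (x - y) * (f x - f y) ≤ c * (x - y) ^ 2 := by
  have hg : ∀ z ∈ J, HasDerivWithinAt (fun z => f z - c * z) (f' z - c) J z := fun z hz =>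
    ((hd z hz).sub ((hasDerivWithinAt_id z J).const_mul c)).congr_deriv (by rw [mul_one])
  have hanti : AntitoneOn (fun z => f z - c * z) J :=
    antitoneOn_of_hasDerivWithinAt_nonpos hJ.convex
      (fun z hz => (hg z hz).continuousWithinAt)
      (fun z hz => (hg z (interior_subset hz)).mono interior_subset)
      (fun z hz => sub_nonpos.2 (hc z (interior_subset hz)))
  rcases le_total x y with h | h
  · have := hanti hx hy h
    simp only at this
    nlinarith
  · have := hanti hy hx h
    simp only at this
    nlinarith

/-- Grönwall's inequality for the modulus of `u` when `u * u' ≤ c * u ^ 2`. -/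
theorem abs_le_exp_mul_abs_of_mul_deriv_le {u u' : ℝ → ℝ} {c a b : ℝ}
    (hu : ∀ t ∈ Icc a b, HasDerivAt u (u' t) t)
    (hle : ∀ t ∈ Icc a b, u t * u' t ≤ c * u t ^ 2) {t : ℝ} (ht : t ∈ Icc a b) :
    |u t| ≤ Real.exp (c * (t - a)) * |u a| := by
  have hg : ∀ s ∈ Icc a b, HasDerivAt (fun s => (Real.exp (-c * (s - a)) * u s) ^ 2)
      (2 * Real.exp (-c * (s - a)) ^ 2 * (u s * u' s - c * u s ^ 2)) s := fun s hs => by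
    have hexp : HasDerivAt (fun s => Real.exp (-c * (s - a))) (Real.exp (-c * (s - a)) * -c) s := by
      simpa using (((hasDerivAt_id s).sub_const a).const_mul (-c)).exp
    refine ((hexp.mul (hu s hs)).pow 2).congr_deriv ?_
    simp only [Pi.mul_apply]
    push_cast
    ring
  have hanti : AntitoneOn (fun s => (Real.exp (-c * (s - a)) * u s) ^ 2) (Icc a b) :=
    antitoneOn_of_hasDerivWithinAt_nonpos (convex_Icc a b)
      (fun s hs => (hg s hs).continuousAt.continuousWithinAt)
      (fun s hs => (hg s (interior_subset hs)).hasDerivWithinAt)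
      (fun s hs => mul_nonpos_of_nonneg_of_nonpos (by positivity)
        (sub_nonpos.2 (hle s (interior_subset hs))))
  have h := sq_le_sq.1 (hanti (left_mem_Icc.2 (ht.1.trans ht.2)) ht ht.1)
  simp only [sub_self, mul_zero, Real.exp_zero, one_mul, abs_mul, Real.abs_exp] at h
  calc |u t| = Real.exp (c * (t - a)) * (Real.exp (-c * (t - a)) * |u t|) := by
        rw [← mul_assoc, ← Real.exp_add]; simp
    _ ≤ _ := by gcongr

/-- Exponential contraction of two solutions of a nonautonomous scalar ODE
whose drift has state-derivative at most `−m/2` on an interval `J` containing both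
trajectories. -/
theorem two_solutions_exponential_contraction
    (m : ℝ) (hm : 0 < m)
    (J : Set ℝ) (hJ : J.OrdConnected)
    (t₀ t₁ : ℝ) (ht : t₀ ≤ t₁)
    (F F' : ℝ → ℝ → ℝ)
    (hd : ∀ t ∈ Icc t₀ t₁, ∀ ξ ∈ J, HasDerivWithinAt (F t) (F' t ξ) J ξ)
    (hF' : ∀ t ∈ Icc t₀ t₁, ∀ ξ ∈ J, F' t ξ ≤ -m / 2)
    (ξ₁ ξ₂ : ℝ → ℝ)
    (hξ₁ : ∀ t ∈ Icc t₀ t₁, HasDerivAt ξ₁ (F t (ξ₁ t)) t)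
    (hξ₂ : ∀ t ∈ Icc t₀ t₁, HasDerivAt ξ₂ (F t (ξ₂ t)) t)
    (hmem₁ : ∀ t ∈ Icc t₀ t₁, ξ₁ t ∈ J)
    (hmem₂ : ∀ t ∈ Icc t₀ t₁, ξ₂ t ∈ J) :
    ∀ t ∈ Icc t₀ t₁,
      |ξ₁ t - ξ₂ t| ≤ Real.exp (-(m / 2) * (t - t₀)) * |ξ₁ t₀ - ξ₂ t₀| := by
  intro t ht
  refine abs_le_exp_mul_abs_of_mul_deriv_le (u := fun s => ξ₁ s - ξ₂ s)
    (fun s hs => (hξ₁ s hs).sub (hξ₂ s hs)) (fun s hs => ?_) ht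
  exact sub_mul_sub_le_of_hasDerivWithinAt_le hJ (hd s hs)
    (fun x hx => (hF' s hs x hx).trans_eq (neg_div 2 m)) (hmem₁ s hs) (hmem₂ s hs)
end

section
/- Suppose N ≥ 4 and the first four modes form a rectangle: ⟨μ^(2) − μ^(1), μ^(3) − μ^(1)⟩ = 0 and μ^(4) = μ^(2) + μ^(3) − μ^(1). Let κ > 0 and suppose p ∈ ℝ^ϖ satisfies two-mode dominance for the diagonal pair (1,4) with margin parameter κ, i.e. ‖p − μ^(k)‖² ≥ min(‖p − μ^(1)‖², ‖p − μ^(4)‖²) + 2σ̃²κ for every k ∉ {1,4}. Then, with C_π := max(π_1/π_4, π_4/π_1), the responsibilities satisfy min(γ_1(p), γ_4(p)) ≤ C_π/(C_π + exp(2κ)) ≤ C_π exp(−2κ). -/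
open Set
open scoped InnerProductSpace

/-- British flag theorem: for a point `p` and a rectangle, the sums of the squared distances to
opposite vertices agree. -/
theorem norm_sub_sq_add_norm_sub_sq_of_rectangle {E : Type*} [NormedAddCommGroup E]
    [InnerProductSpace ℝ E] {a b c d : E} (hright : ⟪b - a, c - a⟫_ℝ = 0) (hd : d = b + c - a)
    (p : E) : ‖p - a‖ ^ 2 + ‖p - d‖ ^ 2 = ‖p - b‖ ^ 2 + ‖p - c‖ ^ 2 := by
  have hb : p - b = (p - a) - (b - a) := by abel
  have hc : p - c = (p - a) - (c - a) := by abel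
  have hd' : p - d = (p - a) - ((b - a) + (c - a)) := by rw [hd]; abel
  rw [hb, hc, hd', norm_sub_sq_real (p - a) (b - a + (c - a)), norm_sub_sq_real (p - a) (b - a),
    norm_sub_sq_real (p - a) (c - a), norm_add_sq_real,
    inner_add_right, hright]
  ring

/-- If `y` is farther from mode `j` than from mode `i`, with a squared-distance gap of at least
`2σ²t`, then the responsibility of mode `j` at `y` is at most `C / (C + exp t)`, where `C` bounds
the weight ratio `π j / π i`. -/
theorem resp_le_of_sq_dist_gap {ϖ N : ℕ} {μ : Fin N → EuclideanSpace ℝ (Fin ϖ)} {π : Fin N → ℝ}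
    (hπ : ∀ k, 0 < π k) {σ : ℝ} (hσ : 0 < σ) {i j : Fin N} (hij : i ≠ j)
    {y : EuclideanSpace ℝ (Fin ϖ)} {t C : ℝ} (hC : π j / π i ≤ C)
    (hgap : ‖y - μ i‖ ^ 2 + 2 * σ ^ 2 * t ≤ ‖y - μ j‖ ^ 2) :
    resp μ π σ j y ≤ C / (C + Real.exp t) := by
  have hC0 : 0 < C := (div_pos (hπ j) (hπ i)).trans_le hC
  have hterm : ∀ m, 0 < π m * Real.exp (-‖y - μ m‖ ^ 2 / (2 * σ ^ 2)) :=
    fun m => mul_pos (hπ m) (Real.exp_pos _)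
  have hsum : π i * Real.exp (-‖y - μ i‖ ^ 2 / (2 * σ ^ 2)) +
      π j * Real.exp (-‖y - μ j‖ ^ 2 / (2 * σ ^ 2)) ≤
      ∑ m : Fin N, π m * Real.exp (-‖y - μ m‖ ^ 2 / (2 * σ ^ 2)) :=
    Finset.add_le_sum (fun m _ => (hterm m).le) (Finset.mem_univ i) (Finset.mem_univ j) hij
  have hexp : Real.exp (-‖y - μ j‖ ^ 2 / (2 * σ ^ 2)) * Real.exp t ≤
      Real.exp (-‖y - μ i‖ ^ 2 / (2 * σ ^ 2)) := by
    rw [← Real.exp_add, Real.exp_le_exp, ← le_sub_iff_add_le, div_le_iff₀ (by positivity),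
      sub_mul, div_mul_cancel₀ _ (by positivity)]
    linarith
  have hmul : π j * Real.exp (-‖y - μ j‖ ^ 2 / (2 * σ ^ 2)) * Real.exp t ≤
      C * (π i * Real.exp (-‖y - μ i‖ ^ 2 / (2 * σ ^ 2))) := by
    rw [mul_assoc, ← mul_assoc C]
    exact mul_le_mul ((div_le_iff₀ (hπ i)).1 hC) hexp (by positivity)
      (mul_pos hC0 (hπ i)).le
  rw [resp, div_le_div_iff₀ ((add_pos (hterm i) (hterm j)).trans_le hsum) (by positivity)]
  linarith [mul_le_mul_of_nonneg_left hsum hC0.le]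

/-- Diagonal avoidance on a grid: if four modes form a rectangle and the
dominant pair is the diagonal `(i₁, i₄)` with margin `κ`, then one of the two diagonal
responsibilities is at most `C_π/(C_π + e^{2κ}) ≤ C_π e^{−2κ}`. -/
theorem diagonal_responsibility_bound
    (ϖ N : ℕ) (hϖ : 1 ≤ ϖ) (hN : 4 ≤ N)
    (μ : Fin N → EuclideanSpace ℝ (Fin ϖ)) (π : Fin N → ℝ)
    (hπpos : ∀ k, 0 < π k) (hπsum : ∑ k : Fin N, π k = 1)
    (σ : ℝ) (hσ : 0 < σ)
    (i₁ i₂ i₃ i₄ : Fin N)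
    (hne : i₁ ≠ i₂ ∧ i₁ ≠ i₃ ∧ i₁ ≠ i₄ ∧ i₂ ≠ i₃ ∧ i₂ ≠ i₄ ∧ i₃ ≠ i₄)
    (hrect₁ : ⟪μ i₂ - μ i₁, μ i₃ - μ i₁⟫_ℝ = 0)
    (hrect₂ : μ i₄ = μ i₂ + μ i₃ - μ i₁)
    (κ : ℝ) (hκ : 0 < κ)
    (p : EuclideanSpace ℝ (Fin ϖ))
    (hdom : TwoModeDominance μ σ i₁ i₄ κ p)
    (Cπ : ℝ) (hCπ : Cπ = max (π i₁ / π i₄) (π i₄ / π i₁)) :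
    min (resp μ π σ i₁ p) (resp μ π σ i₄ p) ≤ Cπ / (Cπ + Real.exp (2 * κ)) ∧
      Cπ / (Cπ + Real.exp (2 * κ)) ≤ Cπ * Real.exp (-(2 * κ)) := by
  obtain ⟨h12, h13, h14, -, h24, h34⟩ := hne
  have hC0 : 0 < Cπ := by
    rw [hCπ]
    exact lt_max_of_lt_left (div_pos (hπpos _) (hπpos _))
  refine ⟨?_, ?_⟩
  · have hflag := norm_sub_sq_add_norm_sub_sq_of_rectangle hrect₁ hrect₂ p
    have h2 := hdom i₂ h12.symm h24
    have h3 := hdom i₃ h13.symm h34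
    rcases le_total (‖p - μ i₁‖ ^ 2) (‖p - μ i₄‖ ^ 2) with h | h
    · rw [min_eq_left h] at h2 h3
      exact (min_le_right _ _).trans (resp_le_of_sq_dist_gap hπpos hσ h14
        (hCπ ▸ le_max_right _ _) (by linarith))
    · rw [min_eq_right h] at h2 h3
      exact (min_le_left _ _).trans (resp_le_of_sq_dist_gap hπpos hσ h14.symm
        (hCπ ▸ le_max_left _ _) (by linarith))
  · rw [Real.exp_neg, ← div_eq_mul_inv]
    exact div_le_div_of_nonneg_left hC0.le (Real.exp_pos _) (by linarith)
end

section
/- Let y = μ^(i) + ξ ℓ v + w with ξ ∈ ℝ and ⟨w, v⟩ = 0. Then the N-component mixture responsibility of mode j satisfies γ_j(y) ≤ (π_j/π_i) exp(−(1 − 2ξ) ℓ²/(2σ̃²)). In particular, if ξ ≤ 1/4 and ℓ² ≥ 4κσ̃² for some κ > 0, then γ_j(y) ≤ (π_j/π_i) exp(−κ). -/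
open Set
open scoped InnerProductSpace

/-- The responsibility of mode `j` is at most the ratio of the weighted densities of modes `j`
and `i`. -/
theorem resp_le_ratio {ϖ N : ℕ} (μ : Fin N → EuclideanSpace ℝ (Fin ϖ)) (π : Fin N → ℝ)
    (hπ : ∀ k, 0 < π k) (σ : ℝ) (i j : Fin N) (y : EuclideanSpace ℝ (Fin ϖ)) :
    resp μ π σ j y ≤
      π j / π i * Real.exp (-(‖y - μ j‖ ^ 2 - ‖y - μ i‖ ^ 2) / (2 * σ ^ 2)) := by
  have hterm : ∀ k, 0 < π k * Real.exp (-‖y - μ k‖ ^ 2 / (2 * σ ^ 2)) :=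
    fun k => mul_pos (hπ k) (Real.exp_pos _)
  calc resp μ π σ j y
      ≤ π j * Real.exp (-‖y - μ j‖ ^ 2 / (2 * σ ^ 2)) /
          (π i * Real.exp (-‖y - μ i‖ ^ 2 / (2 * σ ^ 2))) :=
        div_le_div_of_nonneg_left (hterm j).le (hterm i)
          (Finset.single_le_sum (f := fun k => π k * Real.exp (-‖y - μ k‖ ^ 2 / (2 * σ ^ 2)))
            (fun k _ => (hterm k).le) (Finset.mem_univ i))
    _ = π j / π i * Real.exp (-(‖y - μ j‖ ^ 2 - ‖y - μ i‖ ^ 2) / (2 * σ ^ 2)) := by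
        rw [mul_div_mul_comm, ← Real.exp_sub]
        ring_nf

/-- If `w` is orthogonal to `d`, then the squared distances of `ξ d + w` from `d` and from `0`
differ by `(1 - 2ξ) ‖d‖²`. -/
theorem norm_sq_sub_norm_sq_of_inner_eq_zero {E : Type*} [NormedAddCommGroup E]
    [InnerProductSpace ℝ E] (d w : E) (ξ : ℝ) (h : ⟪w, d⟫_ℝ = 0) :
    ‖ξ • d + w - d‖ ^ 2 - ‖ξ • d + w‖ ^ 2 = (1 - 2 * ξ) * ‖d‖ ^ 2 := by
  rw [norm_sub_sq_real, inner_add_left, h, real_inner_smul_left, real_inner_self_eq_norm_sq]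
  ring

/-- For a point `y = μ⁽ⁱ⁾ + ξℓv + w` with `w ⊥ v` on the `(i,j)`-mode
segment, the `N`-component responsibility of mode `j` is bounded by
`(πⱼ/πᵢ) exp(−(1−2ξ)ℓ²/(2σ̃²))`; in particular for `ξ ≤ 1/4` and `ℓ² ≥ 4κσ̃²` it is at most
`(πⱼ/πᵢ) e^{−κ}`. -/
theorem responsibility_bound_along_segment
    (ϖ N : ℕ) (hϖ : 1 ≤ ϖ) (hN : 2 ≤ N)
    (μ : Fin N → EuclideanSpace ℝ (Fin ϖ)) (π : Fin N → ℝ)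
    (hπpos : ∀ k, 0 < π k) (hπsum : ∑ k : Fin N, π k = 1)
    (σt : ℝ) (hσt : 0 < σt)
    (i j : Fin N) (hij : i ≠ j) (hμ : μ i ≠ μ j)
    (ℓ : ℝ) (hℓ : ℓ = ‖μ j - μ i‖)
    (v : EuclideanSpace ℝ (Fin ϖ)) (hv : v = ℓ⁻¹ • (μ j - μ i))
    (ξ : ℝ) (w : EuclideanSpace ℝ (Fin ϖ)) (hw : ⟪w, v⟫_ℝ = 0)
    (y : EuclideanSpace ℝ (Fin ϖ)) (hy : y = μ i + (ξ * ℓ) • v + w) :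
    resp μ π σt j y ≤ π j / π i * Real.exp (-((1 - 2 * ξ) * ℓ ^ 2) / (2 * σt ^ 2)) ∧
      (∀ κ : ℝ, 0 < κ → ξ ≤ 1 / 4 → 4 * κ * σt ^ 2 ≤ ℓ ^ 2 →
        resp μ π σt j y ≤ π j / π i * Real.exp (-κ)) := by
  have hℓpos : 0 < ℓ := by
    rw [hℓ]
    exact norm_pos_iff.mpr (sub_ne_zero.mpr hμ.symm)
  have hd : ℓ • v = μ j - μ i := by
    rw [hv, smul_inv_smul₀ hℓpos.ne']
  have hwd : ⟪w, μ j - μ i⟫_ℝ = 0 := by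
    rw [← hd, real_inner_smul_right, hw, mul_zero]
  have hyi : y - μ i = ξ • (μ j - μ i) + w := by
    rw [hy, mul_smul, hd]
    abel
  have hyj : y - μ j = ξ • (μ j - μ i) + w - (μ j - μ i) := by
    rw [← hyi]
    abel
  have hbound := resp_le_ratio μ π hπpos σt i j y
  rw [hyi, hyj, norm_sq_sub_norm_sq_of_inner_eq_zero _ _ _ hwd, ← hℓ] at hbound
  refine ⟨hbound, fun κ _ hξ hκ => hbound.trans ?_⟩
  have hratio : 0 ≤ π j / π i := (div_pos (hπpos j) (hπpos i)).le
  refine mul_le_mul_of_nonneg_left (Real.exp_le_exp.mpr ?_) hratio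
  rw [div_le_iff₀ (by positivity)]
  nlinarith [mul_nonneg (sub_nonneg.mpr hξ) (sq_nonneg ℓ)]
end
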